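/- arXiv:1312.4446 — 3 statements merged into one kernel-verified Lean document; each statement's English description precedes it below -/
import Mathlib

section
/- For every natural number n, H₀(−2(n+1), 0) = ((n + 1/2)/(n + 1)) · H₀(−2n, 0). -/
/-- The discrete harmonic measure of the tip of the slit in the slit lattice plane,
`H₀(s,k) = (1/(2π)) ∫_{−π}^{π} (cos θ/(1+|sin θ|))^{|k|} e^{−isθ} (1−e^{−2iθ})^{−1/2} dθ`. -/
noncomputable def H0 (s k : ℤ) : ℂ :=
  (1 / (2 * (Real.pi : ℂ))) *
    ∫ θ in (-Real.pi)..Real.pi,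
      ((Real.cos θ / (1 + |Real.sin θ|) : ℝ) : ℂ) ^ k.natAbs *
        Complex.exp (-Complex.I * (s : ℂ) * (θ : ℂ)) *
        ((1 : ℂ) - Complex.exp (-2 * Complex.I * (θ : ℂ))) ^ (-(1 / 2) : ℂ)

lemma H0aux_norm (θ : ℝ) :
    ‖(1 : ℂ) - Complex.exp (-2 * Complex.I * (θ : ℂ))‖ = 2 * |Real.sin θ| := by
  have h := Complex.norm_exp_I_mul_ofReal_sub_one (-2 * θ)
  rw [norm_sub_rev]
  have e : (-2 * Complex.I * (θ : ℂ)) = Complex.I * ((-2 * θ : ℝ) : ℂ) := by push_cast; ring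
  rw [e, h, show -2 * θ / 2 = -θ by ring]
  simp

lemma H0aux_meas :
    Measurable (fun θ : ℝ => ((1 : ℂ) - Complex.exp (-2 * Complex.I * (θ : ℂ))) ^ (-(1 / 2) : ℂ)) := by
  apply Measurable.pow_const
  exact Continuous.measurable (by fun_prop)

lemma H0aux_int (a b : ℝ) : IntervalIntegrable
    (fun θ : ℝ => ((1 : ℂ) - Complex.exp (-2 * Complex.I * (θ : ℂ))) ^ (-(1 / 2) : ℂ))
    MeasureTheory.volume a b := by
  have hper : Function.Periodic
      (fun θ : ℝ => ((1 : ℂ) - Complex.exp (-2 * Complex.I * (θ : ℂ))) ^ (-(1 / 2) : ℂ)) Real.pi := by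
    intro θ
    have : Complex.exp (-2 * Complex.I * ((θ + Real.pi : ℝ) : ℂ))
        = Complex.exp (-2 * Complex.I * (θ : ℂ)) := by
      have := Complex.exp_periodic.sub_eq (-2 * Complex.I * (θ : ℂ))
      rw [← this]
      congr 1
      push_cast; ring
    simp only [this]
  refine hper.intervalIntegrable Real.pi_ne_zero (t := -(Real.pi / 2)) ?_ a b
  have hc : IntervalIntegrable (fun x : ℝ => (x : ℂ) ^ (-(1 / 2) : ℂ)) MeasureTheory.volume
      (-(Real.pi / 2)) (-(Real.pi / 2) + Real.pi) :=
    intervalIntegral.intervalIntegrable_cpow' (by norm_num)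
  refine hc.mono_fun H0aux_meas.aestronglyMeasurable ?_
  refine (MeasureTheory.ae_restrict_iff' measurableSet_uIoc).2 (Filter.Eventually.of_forall ?_)
  intro θ hθ
  have hpi := Real.pi_pos
  rw [Set.uIoc_of_le (by linarith)] at hθ
  have habs : |θ| ≤ Real.pi / 2 := abs_le.2 ⟨by linarith [hθ.1], by linarith [hθ.2]⟩
  by_cases h0 : θ = 0
  · subst h0; simp
  have hs := Real.mul_abs_le_abs_sin habs
  have hp : 0 < |θ| := abs_pos.2 h0
  have hle : |θ| ≤ 2 * |Real.sin θ| := by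
    have h4 := Real.pi_le_four
    have : 1 / 2 ≤ 2 / Real.pi := by
      rw [div_le_div_iff₀ (by norm_num) hpi]; linarith
    nlinarith
  have e : (-(1 / 2) : ℂ) = ((-(1 / 2) : ℝ) : ℂ) := by push_cast; rfl
  have hn : (1 : ℂ) - Complex.exp (-2 * Complex.I * (θ : ℂ)) ≠ 0 := by
    rw [← norm_pos_iff, H0aux_norm]; linarith
  beta_reduce
  rw [e, Complex.norm_cpow_real, Complex.norm_cpow_real, H0aux_norm, Complex.norm_real,
    Real.norm_eq_abs]
  exact Real.rpow_le_rpow_of_nonpos hp hle (by norm_num)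

lemma H0aux_slit (θ : ℝ) (h : Real.sin θ ≠ 0) :
    (1 : ℂ) - Complex.exp (-2 * Complex.I * (θ : ℂ)) ∈ Complex.slitPlane := by
  left
  have e : (-2 * Complex.I * (θ : ℂ)) = ((-2 * θ : ℝ) : ℂ) * Complex.I := by push_cast; ring
  rw [e, Complex.sub_re, Complex.exp_ofReal_mul_I_re, neg_mul, Real.cos_neg, Real.cos_two_mul,
    Real.cos_sq']
  have := sq_pos_of_ne_zero h
  simp only [Complex.one_re]
  linarith

lemma H0aux_cont (n : ℕ) : Continuous (fun θ : ℝ =>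
    Complex.exp (2 * ((n : ℂ) + 1) * Complex.I * (θ : ℂ)) *
      ((1 : ℂ) - Complex.exp (-2 * Complex.I * (θ : ℂ))) ^ ((1 / 2) : ℂ)) := by
  refine Continuous.mul (by fun_prop) ?_
  rw [continuous_iff_continuousAt]
  intro θ
  have hb : ContinuousAt (fun θ : ℝ => (1 : ℂ) - Complex.exp (-2 * Complex.I * (θ : ℂ))) θ := by
    fun_prop
  by_cases h : Real.sin θ = 0
  · have h0 : (1 : ℂ) - Complex.exp (-2 * Complex.I * (θ : ℂ)) = 0 := by
      rw [← norm_eq_zero, H0aux_norm, h]; simp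
    have hc : ContinuousAt (fun z : ℂ => z ^ ((1 / 2) : ℂ))
        ((1 : ℂ) - Complex.exp (-2 * Complex.I * (θ : ℂ))) := by
      rw [h0]
      have := Complex.continuousAt_cpow_zero_of_re_pos (z := (1 / 2 : ℂ)) (by norm_num)
      exact ContinuousAt.comp (f := fun z : ℂ => (z, (1 / 2 : ℂ))) this (by fun_prop)
    exact ContinuousAt.comp (f := fun θ : ℝ => (1 : ℂ) - Complex.exp (-2 * Complex.I * (θ : ℂ)))
      hc hb
  · exact hb.cpow continuousAt_const (H0aux_slit θ h)

lemma H0aux_deriv (n : ℕ) (θ : ℝ) (h : Real.sin θ ≠ 0) : HasDerivAt (fun θ : ℝ =>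
    Complex.exp (2 * ((n : ℂ) + 1) * Complex.I * (θ : ℂ)) *
      ((1 : ℂ) - Complex.exp (-2 * Complex.I * (θ : ℂ))) ^ ((1 / 2) : ℂ))
    (2 * Complex.I * (((n : ℂ) + 1) *
      (Complex.exp (2 * ((n : ℂ) + 1) * Complex.I * (θ : ℂ)) *
        ((1 : ℂ) - Complex.exp (-2 * Complex.I * (θ : ℂ))) ^ (-(1 / 2) : ℂ))
      - ((n : ℂ) + 1 / 2) * (Complex.exp (2 * (n : ℂ) * Complex.I * (θ : ℂ)) *
        ((1 : ℂ) - Complex.exp (-2 * Complex.I * (θ : ℂ))) ^ (-(1 / 2) : ℂ)))) θ := by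
  have hs := H0aux_slit θ h
  have hid : HasDerivAt (fun z : ℂ => z) 1 (θ : ℂ) := hasDerivAt_id _
  have h1 := (hid.const_mul (2 * ((n : ℂ) + 1) * Complex.I)).cexp
  have h2 := (((hid.const_mul (-2 * Complex.I)).cexp).const_sub 1).cpow_const (c := (1 / 2 : ℂ)) hs
  have h3 := (h1.mul h2).comp_ofReal
  refine h3.congr_deriv ?_
  have hz := Complex.slitPlane_ne_zero hs
  set W := Complex.exp (-2 * Complex.I * (θ : ℂ)) with hW
  have e1 : Complex.exp (2 * (n : ℂ) * Complex.I * (θ : ℂ)) =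
      Complex.exp (2 * ((n : ℂ) + 1) * Complex.I * (θ : ℂ)) * W := by
    rw [hW, ← Complex.exp_add]; congr 1; ring
  have e2 : (1 - W) ^ (1 / 2 : ℂ) = (1 - W) ^ (-(1 / 2) : ℂ) * (1 - W) := by
    have := Complex.cpow_add (-(1 / 2) : ℂ) 1 hz
    rw [Complex.cpow_one] at this
    rw [← this]; norm_num
  rw [e1, show (1 / 2 - 1 : ℂ) = -(1 / 2) by norm_num, e2]
  ring

lemma H0aux_eq (n : ℕ) : H0 (-(2 * n)) 0 = (1 / (2 * (Real.pi : ℂ))) *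
    ∫ θ in (-Real.pi)..Real.pi, Complex.exp (2 * (n : ℂ) * Complex.I * (θ : ℂ)) *
        ((1 : ℂ) - Complex.exp (-2 * Complex.I * (θ : ℂ))) ^ (-(1 / 2) : ℂ) := by
  unfold H0
  congr 1
  apply intervalIntegral.integral_congr
  intro θ _
  simp only [Int.natAbs_zero, pow_zero, one_mul]
  congr 2
  push_cast; ring

lemma H0aux_int2 (c : ℂ) : IntervalIntegrable (fun θ : ℝ => Complex.exp (c * (θ : ℂ)) *
        ((1 : ℂ) - Complex.exp (-2 * Complex.I * (θ : ℂ))) ^ (-(1 / 2) : ℂ))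
    MeasureTheory.volume (-Real.pi) Real.pi :=
  (H0aux_int _ _).continuousOn_mul (Continuous.continuousOn (by fun_prop))

theorem H0_recursion (n : ℕ) :
    H0 (-(2 * ((n : ℤ) + 1))) 0 = (((n : ℂ) + 1 / 2) / ((n : ℂ) + 1)) * H0 (-(2 * n)) 0 := by
  have hA := H0aux_eq (n + 1)
  push_cast at hA
  rw [hA, H0aux_eq n]
  have i1 := H0aux_int2 (2 * ((n : ℂ) + 1) * Complex.I)
  have i2 := H0aux_int2 (2 * (n : ℂ) * Complex.I)
  have hle : -Real.pi ≤ Real.pi := by linarith [Real.pi_pos]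
  have key := MeasureTheory.integral_eq_of_hasDerivAt_off_countable_of_le _ _ hle
    (s := {-Real.pi, 0, Real.pi}) (Set.Countable.insert _ (Set.Countable.insert _ (Set.countable_singleton _)))
    (H0aux_cont n).continuousOn
    (fun x hx => H0aux_deriv n x (by
      obtain ⟨⟨h1, h2⟩, h3⟩ := hx
      intro h
      apply h3
      right; left
      exact (Real.sin_eq_zero_iff_of_lt_of_lt h1 h2).1 h))
    (((i1.const_mul ((n : ℂ) + 1)).sub (i2.const_mul ((n : ℂ) + 1 / 2))).const_mul (2 * Complex.I))
  rw [intervalIntegral.integral_const_mul, intervalIntegral.integral_sub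
    (i1.const_mul ((n : ℂ) + 1)) (i2.const_mul ((n : ℂ) + 1 / 2)),
    intervalIntegral.integral_const_mul, intervalIntegral.integral_const_mul] at key
  have z : ∀ θ : ℝ, Real.sin θ = 0 → (1 : ℂ) - Complex.exp (-2 * Complex.I * (θ : ℂ)) = 0 := by
    intro θ h
    rw [← norm_eq_zero, H0aux_norm, h]; simp
  rw [z Real.pi (by simp), z (-Real.pi) (by simp), Complex.zero_cpow (by norm_num), mul_zero,
    mul_zero, sub_zero] at key
  have hn : (n : ℂ) + 1 ≠ 0 := by exact_mod_cast Nat.succ_ne_zero n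
  have key2 := (mul_eq_zero.1 key).resolve_left (by simp)
  rw [sub_eq_zero] at key2
  generalize (∫ θ in (-Real.pi)..Real.pi, Complex.exp (2 * ((n : ℂ) + 1) * Complex.I * (θ : ℂ)) *
        ((1 : ℂ) - Complex.exp (-2 * Complex.I * (θ : ℂ))) ^ (-(1 / 2) : ℂ)) = A at *
  rw [div_mul_eq_mul_div (_ + _ : ℂ), eq_div_iff hn]
  linear_combination (1 / (2 * (Real.pi : ℂ))) * key2
end

section
/- The sequence n ↦ Real.sqrt(π·n) · H₀(−2n, 0) tends to 1 (in ℂ) as n → ∞; that is, the discrete harmonic measure of the tip of the slit at lattice distance 2n from the tip is asymptotic to 1/√(πn). -/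
lemma aux_re (θ : ℝ) : ((1 : ℂ) - Complex.exp (-2 * Complex.I * (θ : ℂ))).re
    = 2 * Real.sin θ ^ 2 := by
  have : (-2 * Complex.I * (θ : ℂ)) = ((-(2 * θ) : ℝ) : ℂ) * Complex.I := by push_cast; ring
  rw [this, Complex.sub_re, Complex.exp_ofReal_mul_I_re, Real.cos_neg, Real.cos_two_mul,
    Real.cos_sq']
  simp; ring

lemma aux_norm (θ : ℝ) : 2 * |Real.sin θ| ≤ ‖(1 : ℂ) - Complex.exp (-2 * Complex.I * (θ : ℂ))‖ := by
  apply le_of_sq_le_sq _ (norm_nonneg _)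
  rw [← Complex.normSq_eq_norm_sq, Complex.normSq_apply, aux_re]
  have : (-2 * Complex.I * (θ : ℂ)) = ((-(2 * θ) : ℝ) : ℂ) * Complex.I := by push_cast; ring
  rw [this, Complex.sub_im, Complex.exp_ofReal_mul_I_im, Real.sin_neg, Real.sin_two_mul]
  rw [mul_pow, sq_abs]
  have := Real.sin_sq_add_cos_sq θ
  simp only [Complex.one_im]
  have h : Real.cos θ ^ 2 = 1 - Real.sin θ ^ 2 := by linarith
  have : (0 - -(2 * Real.sin θ * Real.cos θ)) * (0 - -(2 * Real.sin θ * Real.cos θ))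
    = 4 * Real.sin θ ^ 2 * Real.cos θ ^ 2 := by ring
  rw [this, h]
  apply le_of_eq
  ring

noncomputable def auxg (θ : ℝ) : ℂ :=
  ((1 : ℂ) - Complex.exp (-2 * Complex.I * (θ : ℂ))) ^ (-(1 / 2) : ℂ)

noncomputable def auxf (θ : ℝ) : ℂ :=
  ((1 : ℂ) - Complex.exp (-2 * Complex.I * (θ : ℂ))) ^ (1 / 2 : ℂ)

lemma auxg_per : Function.Periodic auxg Real.pi := by
  intro θ
  unfold auxg
  congr 2
  rw [show (-2 * Complex.I * ((θ + Real.pi : ℝ) : ℂ)) =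
    -2 * Complex.I * θ - 2 * Real.pi * Complex.I by push_cast; ring]
  exact Complex.exp_periodic.sub_eq _

lemma auxg_int (a b : ℝ) : IntervalIntegrable auxg MeasureTheory.volume a b := by
  refine auxg_per.intervalIntegrable Real.pi_pos.ne' (t := -(Real.pi/2)) ?_ a b
  have h0 : IntervalIntegrable (fun x : ℝ => (x : ℂ) ^ (-(1/2) : ℂ)) MeasureTheory.volume
      (-(Real.pi/2)) (-(Real.pi/2) + Real.pi) :=
    intervalIntegral.intervalIntegrable_cpow' (by norm_num)
  refine h0.norm.mono_fun' ?_ ?_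
  · apply Measurable.aestronglyMeasurable
    unfold auxg
    fun_prop
  · refine (MeasureTheory.ae_restrict_iff' measurableSet_uIoc).mpr (Filter.Eventually.of_forall ?_)
    intro x hx
    rw [Set.uIoc_of_le (by linarith [Real.pi_pos])] at hx
    have hx' : |x| ≤ Real.pi / 2 := abs_le.2 ⟨hx.1.le, by linarith [hx.2]⟩
    have e : (-(1/2) : ℂ) = ((-(1/2) : ℝ) : ℂ) := by push_cast; rfl
    simp only [auxg]
    rw [e, Complex.norm_cpow_real, Complex.norm_cpow_real]
    by_cases h : x = 0
    · simp [h]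
    refine Real.rpow_le_rpow_of_nonpos (by simpa using h) ?_ (by norm_num)
    refine le_trans ?_ (aux_norm x)
    have h1 := Real.mul_abs_le_abs_sin hx'
    have h2 : (1:ℝ)/2 ≤ 2 / Real.pi := by
      rw [div_le_div_iff₀ (by norm_num) Real.pi_pos]; linarith [Real.pi_le_four]
    have h3 := mul_le_mul_of_nonneg_right h2 (abs_nonneg x)
    simp only [Complex.norm_real, Real.norm_eq_abs]
    linarith

lemma auxf_cont : Continuous auxf := by
  rw [continuous_iff_continuousAt]
  intro θ
  unfold auxf
  have := Complex.continuousAt_cpow_const_of_re_pos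
    (z := (1 : ℂ) - Complex.exp (-2 * Complex.I * (θ : ℂ))) (w := 1/2)
    (Or.inl (by rw [aux_re]; positivity)) (by norm_num)
  exact ContinuousAt.comp (f := fun θ : ℝ => (1 : ℂ) - Complex.exp (-2 * Complex.I * (θ : ℂ)))
    this (by fun_prop)

lemma auxf_eq (θ : ℝ) : auxf θ = (1 - Complex.exp (-2 * Complex.I * (θ : ℂ))) * auxg θ := by
  unfold auxf auxg
  by_cases h : (1 - Complex.exp (-2 * Complex.I * (θ : ℂ))) = 0
  · rw [h]; simp
  · nth_rw 2 [← Complex.cpow_one (1 - Complex.exp (-2 * Complex.I * (θ : ℂ)))]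
    rw [← Complex.cpow_add _ _ h]; norm_num

lemma auxf_integral : ∫ θ in (-Real.pi)..Real.pi, auxf θ = 2 * Real.pi := by
  let G : ℂ → ℂ := fun z => (1 - z) ^ (1/2 : ℂ)
  have h1 : Real.circleAverage G 0 1 = G 0 := by
    apply circleAverage_of_differentiable_on_off_countable Set.countable_empty
    · intro z hz
      apply ContinuousAt.continuousWithinAt
      have hz' : ‖z‖ ≤ 1 := by simpa using hz
      have := Complex.continuousAt_cpow_const_of_re_pos (z := (1 : ℂ) - z) (w := 1/2)
        (Or.inl (by
          have := Complex.re_le_norm z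
          simp; linarith)) (by norm_num)
      exact ContinuousAt.comp (f := fun z : ℂ => (1 : ℂ) - z) this (by fun_prop)
    · intro z hz
      have hz' : ‖z‖ < 1 := by simpa using hz
      refine DifferentiableAt.cpow (by fun_prop) (by fun_prop) (Or.inl ?_)
      have := Complex.re_le_norm z
      simp; linarith
  have h2 : ∀ θ, auxf θ = (fun t : ℝ => G (circleMap 0 1 t)) (-2 * θ) := by
    intro θ
    simp only [auxf, G, circleMap]
    congr 2
    simp
    ring_nf
  have hper : Function.Periodic (fun t : ℝ => G (circleMap 0 1 t)) (2 * Real.pi) :=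
    fun t => by simp [periodic_circleMap 0 1 t]
  rw [intervalIntegral.integral_congr (fun θ _ => h2 θ),
    intervalIntegral.integral_comp_mul_left (fun t : ℝ => G (circleMap 0 1 t))
      (by norm_num : (-2 : ℝ) ≠ 0)]
  have h3 := hper.intervalIntegral_add_zsmul_eq 2 (-2 * Real.pi)
  rw [Real.circleAverage_def] at h1
  have h4 := hper.intervalIntegral_add_eq (-2 * Real.pi) 0
  have hG0 : G 0 = 1 := by simp [G]
  rw [hG0] at h1
  have hpi : (Real.pi : ℂ) ≠ 0 := by exact_mod_cast Real.pi_ne_zero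
  have h5 : ∫ t in (0:ℝ)..2 * Real.pi, G (circleMap 0 1 t) = 2 * Real.pi := by
    rw [Complex.real_smul] at h1
    push_cast at h1
    field_simp at h1
    exact h1
  have hi : ∀ t₁ t₂, IntervalIntegrable (fun t : ℝ => G (circleMap 0 1 t)) MeasureTheory.volume t₁ t₂ := by
    intro t₁ t₂
    apply Continuous.intervalIntegrable
    have : (fun t : ℝ => G (circleMap 0 1 t)) = fun t => auxf (-t/2) := by
      funext t; rw [h2]; congr 2; ring
    rw [this]
    exact auxf_cont.comp (by fun_prop)
  have h6 := h3 hi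
  rw [zero_add] at h4
  rw [h4, h5] at h6
  rw [intervalIntegral.integral_symm]
  rw [show -2 * Real.pi + (2:ℤ) • (2 * Real.pi) = -2 * -Real.pi by simp; ring] at h6
  rw [h6]
  simp

noncomputable def auxA (n : ℤ) : ℂ :=
  ∫ θ in (-Real.pi)..Real.pi, Complex.exp (2 * Complex.I * n * θ) * auxg θ

lemma auxA_int (n : ℤ) (a b : ℝ) : IntervalIntegrable
    (fun θ : ℝ => Complex.exp (2 * Complex.I * n * θ) * auxg θ) MeasureTheory.volume a b :=
  (auxg_int a b).continuousOn_mul (by fun_prop)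

lemma auxA_rec (n : ℤ) : 2 * n * auxA n = (2 * n - 1) * auxA (n - 1) := by
  have key := MeasureTheory.integral_eq_of_hasDerivAt_off_countable
    (fun θ : ℝ => Complex.exp (2 * Complex.I * n * θ) * auxf θ)
    (fun θ : ℝ => (Complex.I * (2 * n)) * (Complex.exp (2 * Complex.I * n * θ) * auxg θ)
      - (Complex.I * (2 * n - 1)) * (Complex.exp (2 * Complex.I * (n - 1 : ℤ) * θ) * auxg θ))
    (a := -Real.pi) (b := Real.pi) (s := {0}) (Set.countable_singleton _)
    (by have := auxf_cont; fun_prop)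
    (by
      rintro θ ⟨hθ, h0⟩
      rw [min_eq_left (by linarith [Real.pi_pos]), max_eq_right (by linarith [Real.pi_pos])] at hθ
      have hs : Real.sin θ ≠ 0 := fun h =>
        h0 ((Real.sin_eq_zero_iff_of_lt_of_lt hθ.1 hθ.2).1 h)
      have d1 : HasDerivAt (fun θ : ℝ => Complex.exp (2 * Complex.I * n * θ))
          (Complex.exp (2 * Complex.I * n * θ) * (2 * Complex.I * n)) θ := by
        have := (((hasDerivAt_id (θ : ℂ)).const_mul (2 * Complex.I * n)).cexp).comp_ofReal
        simpa using this
      have d2 : HasDerivAt auxf ((1/2 : ℂ) * auxg θ *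
          (-(Complex.exp (-2 * Complex.I * θ) * (-2 * Complex.I)))) θ := by
        have h1 : HasDerivAt (fun z : ℂ => 1 - Complex.exp (-2 * Complex.I * z))
            (-(Complex.exp (-2 * Complex.I * θ) * (-2 * Complex.I))) (θ : ℂ) := by
          have := (((hasDerivAt_id (θ : ℂ)).const_mul (-2 * Complex.I)).cexp).const_sub 1
          simpa using this
        have h2 := (h1.cpow_const (c := 1/2) (Or.inl (by rw [aux_re]; positivity))).comp_ofReal
        rw [show (1/2 - 1 : ℂ) = -(1/2) by norm_num] at h2
        exact h2
      have d3 := d1.mul d2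
      refine d3.congr_deriv ?_
      rw [auxf_eq]
      have e : Complex.exp (2 * Complex.I * (n - 1 : ℤ) * θ) =
          Complex.exp (2 * Complex.I * n * θ) * Complex.exp (-2 * Complex.I * θ) := by
        rw [← Complex.exp_add]; congr 1; push_cast; ring
      rw [e]
      ring)
    (((auxA_int n _ _).const_mul _).sub ((auxA_int (n-1) _ _).const_mul _))
  rw [intervalIntegral.integral_sub ((auxA_int n _ _).const_mul _)
    ((auxA_int (n-1) _ _).const_mul _), intervalIntegral.integral_const_mul,
    intervalIntegral.integral_const_mul] at key
  have hv : ∀ s : ℝ, Real.sin s = 0 → auxf s = 0 := by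
    intro s hs
    have h1 : Complex.exp (-2 * Complex.I * s) = 1 := by
      obtain ⟨k, hk⟩ := Real.sin_eq_zero_iff.1 hs
      rw [Complex.exp_eq_one_iff]
      refine ⟨-k, ?_⟩
      rw [← hk]; push_cast; ring
    rw [auxf, h1]; simp
  rw [hv _ Real.sin_pi, hv _ (by simp)] at key
  change Complex.I * (2 * n) * auxA n - Complex.I * (2 * n - 1) * auxA (n-1) = _ at key
  have : Complex.I * (2 * n * auxA n - (2 * n - 1) * auxA (n - 1)) = 0 := by
    rw [mul_zero, mul_zero, sub_zero] at key
    rw [← key]; ring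
  rcases mul_eq_zero.1 this with h | h
  · exact absurd h Complex.I_ne_zero
  · exact sub_eq_zero.1 h

lemma auxA_zero : auxA 0 = 2 * Real.pi := by
  have h1 := auxA_rec 0
  simp only [Int.cast_zero, mul_zero, zero_mul, zero_sub] at h1
  have h2 : auxA (-1) = 0 := by linear_combination h1
  have h3 : auxA 0 - auxA (-1) = ∫ θ in (-Real.pi)..Real.pi, auxf θ := by
    unfold auxA
    rw [← intervalIntegral.integral_sub (auxA_int 0 _ _) (auxA_int (-1) _ _)]
    refine intervalIntegral.integral_congr fun θ _ => ?_
    simp only [auxf_eq]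
    rw [show (2 * Complex.I * ((-1 : ℤ) : ℂ) * θ) = -2 * Complex.I * θ by push_cast; ring]
    simp
    ring
  rw [h2, auxf_integral, sub_zero] at h3
  exact h3

noncomputable def auxc (n : ℕ) : ℝ := ∏ i ∈ Finset.range n, ((2 * i + 1) / (2 * i + 2) : ℝ)

lemma auxA_nat (n : ℕ) : auxA n = 2 * Real.pi * (auxc n : ℝ) := by
  induction n with
  | zero => simp [auxc, auxA_zero]
  | succ k ih =>
    have h := auxA_rec ((k + 1 : ℕ) : ℤ)
    rw [show (((k + 1 : ℕ) : ℤ) - 1) = (k : ℤ) by push_cast; ring, ih] at h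
    have hc : auxc (k+1) = auxc k * ((2 * k + 1) / (2 * k + 2)) := Finset.prod_range_succ _ _
    rw [hc]
    push_cast at h ⊢
    have hk : (k : ℂ) + 1 ≠ 0 := by exact_mod_cast Nat.succ_ne_zero k
    have hk2 : 2 * (k : ℂ) + 2 ≠ 0 := by
      rw [show 2 * (k : ℂ) + 2 = 2 * (k + 1) by ring]; exact mul_ne_zero two_ne_zero hk
    apply mul_left_cancel₀ hk2
    rw [show (2 * (k : ℂ) + 2) * (2 * Real.pi * ((auxc k : ℂ) * ((2 * k + 1) / (2 * k + 2)))) =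
      (2 * Real.pi * (auxc k : ℂ) * (2 * k + 1)) * ((2 * k + 2) / (2 * k + 2)) by ring,
      div_self hk2]
    linear_combination h

lemma auxc_sq (n : ℕ) : auxc n ^ 2 * ((2 * n + 1) * Real.Wallis.W n) = 1 := by
  induction n with
  | zero => simp [auxc, Real.Wallis.W]
  | succ k ih =>
    have hc : auxc (k+1) = auxc k * ((2 * k + 1) / (2 * k + 2)) := Finset.prod_range_succ _ _
    rw [hc, Real.Wallis.W_succ]
    refine Eq.trans ?_ ih
    push_cast
    field_simp
    ring

lemma auxc_nonneg (n : ℕ) : 0 ≤ auxc n := Finset.prod_nonneg fun i _ => by positivity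

lemma H0_eq (n : ℕ) : H0 (-(2 * n)) 0 = (auxc n : ℝ) := by
  have : H0 (-(2 * n)) 0 = (1 / (2 * (Real.pi : ℂ))) * auxA n := by
    unfold H0 auxA auxg
    congr 1
    refine intervalIntegral.integral_congr fun θ _ => ?_
    simp only [Int.natAbs_zero, pow_zero, one_mul]
    congr 2
    push_cast
    ring
  rw [this, auxA_nat]
  have hpi : (Real.pi : ℂ) ≠ 0 := by exact_mod_cast Real.pi_ne_zero
  field_simp

theorem H0_asymptotics :
    Filter.Tendsto (fun n : ℕ => ((Real.sqrt (Real.pi * n) : ℝ) : ℂ) * H0 (-(2 * n)) 0)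
      Filter.atTop (nhds 1) := by
  have h : ∀ n : ℕ, ((Real.sqrt (Real.pi * n) : ℝ) : ℂ) * H0 (-(2 * n)) 0 =
      ((Real.sqrt (Real.pi * ((n : ℝ) / (2 * n + 1)) / Real.Wallis.W n) : ℝ) : ℂ) := by
    intro n
    rw [H0_eq, ← Complex.ofReal_mul]
    congr 1
    have hW := Real.Wallis.W_pos n
    rw [← Real.sqrt_sq (auxc_nonneg n), ← Real.sqrt_mul (by positivity)]
    congr 1
    have := auxc_sq n
    field_simp
    linear_combination n * this
  simp_rw [h]
  have hl : Filter.Tendsto (fun n : ℕ => Real.sqrt (Real.pi * ((n : ℝ) / (2 * n + 1)) /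
      Real.Wallis.W n)) Filter.atTop (nhds 1) := by
    have := ((Stirling.tendsto_self_div_two_mul_self_add_one.const_mul Real.pi).div
      Real.Wallis.tendsto_W_nhds_pi_div_two (by positivity)).sqrt
    rw [show Real.pi * (1/2) / (Real.pi/2) = 1 by field_simp, Real.sqrt_one] at this
    exact this
  exact_mod_cast (Complex.continuous_ofReal.tendsto 1).comp hl
end

section
/- Let m ≥ 1 be an integer and let L : ℤ × ℤ → ℂ satisfy: (i) for all integers s, k with k ≠ 0 or s ≤ −1, L(s+1,k+1) + L(s+1,k−1) + L(s−1,k+1) + L(s−1,k−1) = 4·L(s,k); (ii) for every integer j ≥ 0, L(j,0) = 1 if j = m−1 and L(j,0) = 0 otherwise; (iii) for every ε > 0 there exists R such that ‖L(s,k)‖ ≤ ε whenever |s| + |k| ≥ R. Then the function L′ defined by L′(s,k) := L(s−1,k) − L(−1,0)·H₀(s,k) satisfies (i); it satisfies, for every integer j ≥ 0, L′(j,0) = 1 if j = m and L′(j,0) = 0 otherwise; and it satisfies (iii). -/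
open Real Set Filter Topology MeasureTheory

noncomputable def slitU (θ : ℝ) : ℂ := (1 : ℂ) - Complex.exp (-2 * Complex.I * (θ : ℂ))
noncomputable def slitK (θ : ℝ) : ℂ := slitU θ ^ (-(1 / 2) : ℂ)

theorem slitU_re (θ : ℝ) : (slitU θ).re = 2 * sin θ ^ 2 := by
  have : (-2 * Complex.I * (θ : ℂ)) = ((-(2 * θ) : ℝ) : ℂ) * Complex.I := by push_cast; ring
  rw [slitU, this]
  simp only [Complex.sub_re, Complex.one_re, Complex.exp_ofReal_mul_I_re, cos_neg]
  rw [cos_two_mul, sin_sq]; ring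

theorem slitU_im (θ : ℝ) : (slitU θ).im = 2 * sin θ * cos θ := by
  have : (-2 * Complex.I * (θ : ℂ)) = ((-(2 * θ) : ℝ) : ℂ) * Complex.I := by push_cast; ring
  rw [slitU, this]
  simp only [Complex.sub_im, Complex.one_im, Complex.exp_ofReal_mul_I_im, sin_neg]
  rw [sin_two_mul]; ring

theorem norm_slitU (θ : ℝ) : ‖slitU θ‖ = 2 * |sin θ| := by
  have h : ‖slitU θ‖ ^ 2 = (2 * |sin θ|) ^ 2 := by
    rw [Complex.sq_norm, Complex.normSq_apply, slitU_re, slitU_im, mul_pow, sq_abs]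
    nlinarith [sin_sq_add_cos_sq θ]
  exact (pow_left_inj₀ (norm_nonneg _) (by positivity) two_ne_zero).1 h

theorem norm_slitK (θ : ℝ) : ‖slitK θ‖ = (2 * |sin θ|) ^ (-(1/2) : ℝ) := by
  have := Complex.norm_cpow_real (slitU θ) (-(1/2) : ℝ)
  rw [norm_slitU] at this
  rw [← this, slitK]; push_cast; rfl

theorem slitU_periodic : Function.Periodic slitU π := by
  intro θ
  have : (-2 * Complex.I * ((θ + π : ℝ) : ℂ)) = -2 * Complex.I * (θ : ℂ) - 2 * π * Complex.I := by
    push_cast; ring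
  rw [slitU, this, Complex.exp_periodic.sub_eq, slitU]

theorem slitU_measurable : Measurable slitU := by
  unfold slitU; fun_prop

theorem slitK_measurable : Measurable slitK := by
  unfold slitK; exact slitU_measurable.pow_const _

theorem slitK_intervalIntegrable (a b : ℝ) : IntervalIntegrable slitK volume a b := by
  have hp : Function.Periodic slitK π := fun θ => by
    rw [slitK, slitU_periodic θ, slitK]
  refine hp.intervalIntegrable (t := -(π/2)) pi_ne_zero ?_ a b
  have e : -(π/2) + π = π/2 := by ring
  rw [e]
  have hpos := pi_pos
  have h1 : IntervalIntegrable (fun x : ℝ => |x| ^ (-(1/2) : ℝ)) volume (-(π/2)) (π/2) := by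
    have h0 : IntervalIntegrable (fun x : ℝ => |x| ^ (-(1/2) : ℝ)) volume 0 (π/2) := by
      refine (intervalIntegral.intervalIntegrable_rpow' (r := -(1/2)) (by norm_num)).congr ?_
      intro x hx
      rw [uIoc_of_le (by positivity)] at hx
      simp only [abs_of_pos hx.1]
    have h2 : IntervalIntegrable (fun x : ℝ => |x| ^ (-(1/2) : ℝ)) volume (-(π/2)) 0 := by
      have := (h0.comp_mul_left (c := -1))
      simpa [div_neg] using this.symm
    exact h2.trans h0
  refine h1.mono_fun' slitK_measurable.aestronglyMeasurable ?_
  refine (ae_restrict_iff' measurableSet_uIoc).2 (ae_of_all _ fun x hx => ?_)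
  rw [uIoc_of_le (by linarith)] at hx
  simp only [norm_slitK]
  rcases eq_or_ne x 0 with rfl | hx0
  · simp
  have hb := mul_abs_le_abs_sin (x := x) (abs_le.2 ⟨hx.1.le, hx.2⟩)
  apply rpow_le_rpow_of_nonpos (abs_pos.2 hx0) _ (by norm_num)
  have : (1/2 : ℝ) ≤ 2 / π := by rw [div_le_div_iff₀ two_pos hpos]; linarith [pi_le_four]
  nlinarith [abs_nonneg x]

theorem ae_sin_ne : ∀ᵐ θ : ℝ, sin θ ≠ 0 := by
  have : (Set.range fun n : ℤ => (n : ℝ) * π).Countable := countable_range _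
  filter_upwards [this.ae_notMem volume] with θ hθ h
  exact hθ (sin_eq_zero_iff.1 h)

theorem slitU_slit {θ : ℝ} (h : sin θ ≠ 0) : slitU θ ∈ Complex.slitPlane := by
  left; rw [slitU_re]; positivity

theorem abs_sin_mul_slitK (θ : ℝ) :
    (|sin θ| : ℝ) * slitK θ = 1 / 2 * slitU (-θ) ^ (1/2 : ℂ) := by
  by_cases h : sin θ = 0
  · have h2 : slitU (-θ) = 0 := by rw [← norm_eq_zero, norm_slitU]; simp [h]
    rw [h, h2]; simp
  have hs := slitU_slit h
  have hc : slitU (-θ) = (starRingEnd ℂ) (slitU θ) := by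
    apply Complex.ext
    · simp [slitU_re]
    · simp [slitU_im]
  have h0 : slitU θ ≠ 0 := Complex.slitPlane_ne_zero hs
  have h1 : slitU θ ^ (1/2:ℂ) ≠ 0 := by simp [Complex.cpow_eq_zero_iff, h0]
  have hstar : (starRingEnd ℂ) (1/2:ℂ) = 1/2 := by
    rw [map_div₀, map_one, Complex.conj_ofNat]
  rw [hc, Complex.conj_cpow _ _ (Complex.slitPlane_arg_ne_pi hs), hstar, slitK, Complex.cpow_neg]
  field_simp
  rw [Complex.mul_conj, Complex.normSq_eq_norm_sq]
  have := Complex.norm_cpow_real (slitU θ) (1/2 : ℝ)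
  push_cast at this
  rw [this, ← rpow_natCast, ← rpow_mul (norm_nonneg _), norm_slitU]
  norm_num
  ring

theorem mean_boundary (h : ℂ → ℂ) (B : ℝ → ℝ) (hd : DifferentiableOn ℂ h (Metric.ball 0 1))
    (hB : IntervalIntegrable B volume 0 (2 * π))
    (hb : ∀ r ∈ Ioo (0:ℝ) 1, ∀ᵐ θ : ℝ, ‖h (circleMap 0 r θ)‖ ≤ B θ)
    (hl : ∀ᵐ θ : ℝ, ContinuousAt h (circleMap 0 1 θ)) :
    ∫ θ in (-π)..π, h (circleMap 0 1 θ) = 2 * π * h 0 := by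
  have hev : ∀ᶠ r in 𝓝[<] (1:ℝ), r ∈ Ioo (0:ℝ) 1 := Ioo_mem_nhdsLT one_pos
  have key : ∀ r ∈ Ioo (0:ℝ) 1, ∫ θ in 0..(2*π), h (circleMap 0 r θ) = 2 * π * h 0 := by
    intro r hr
    have : DiffContOnCl ℂ h (Metric.ball 0 |r|) := by
      apply DifferentiableOn.diffContOnCl
      apply hd.mono
      rw [abs_of_pos hr.1]
      exact Metric.closure_ball_subset_closedBall.trans (Metric.closedBall_subset_ball hr.2)
    have h2 := this.circleAverage
    rw [Real.circleAverage_def] at h2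
    rw [← h2, Complex.real_smul]
    push_cast
    have : (π : ℂ) ≠ 0 := by exact_mod_cast pi_ne_zero
    field_simp
  have hT : Tendsto (fun r => ∫ θ in 0..(2*π), h (circleMap 0 r θ)) (𝓝[<] (1:ℝ))
      (𝓝 (∫ θ in 0..(2*π), h (circleMap 0 1 θ))) := by
    apply intervalIntegral.tendsto_integral_filter_of_dominated_convergence B
    · filter_upwards [hev] with r hr
      apply Continuous.aestronglyMeasurable
      refine hd.continuousOn.comp_continuous (continuous_circleMap 0 r) fun θ => ?_
      simp [abs_of_pos hr.1, hr.2]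
    · filter_upwards [hev] with r hr
      filter_upwards [hb r hr] with θ h _ using h
    · exact hB
    · filter_upwards [hl] with θ h _
      have hc : Continuous fun r : ℝ => circleMap 0 r θ := by unfold circleMap; fun_prop
      have := h.tendsto.comp (hc.tendsto 1)
      exact this.mono_left nhdsWithin_le_nhds
  have hT2 : Tendsto (fun r => ∫ θ in 0..(2*π), h (circleMap 0 r θ)) (𝓝[<] (1:ℝ))
      (𝓝 (2 * π * h 0)) := by
    refine tendsto_const_nhds.congr' ?_
    filter_upwards [hev] with r hr using (key r hr).symm
  rw [← tendsto_nhds_unique hT hT2]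
  have hp : Function.Periodic (fun θ => h (circleMap 0 1 θ)) (2 * π) := fun θ => by
    simp only [periodic_circleMap 0 1 θ]
  have := hp.intervalIntegral_add_eq (-π) 0
  rw [show -π + 2 * π = π by ring, zero_add] at this
  exact this

theorem circle_one (θ : ℝ) : 1 - circleMap 0 1 θ ^ 2 = slitU (-θ) := by
  rw [circleMap_zero, slitU, Complex.ofReal_one, one_mul, ← Complex.exp_nat_mul]
  push_cast; ring_nf

theorem half_bound (r : ℝ) (hr : r ∈ Ioo (0:ℝ) 1) (θ : ℝ) :
    |sin θ| ≤ ‖1 - circleMap 0 r θ ^ 2‖ ∧ ‖1 - circleMap 0 r θ ^ 2‖ ≤ 2 := by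
  have e : circleMap 0 r θ = r * circleMap 0 1 θ := by simp [circleMap_zero]
  have n1 : ‖circleMap 0 1 θ ^ 2‖ = 1 := by simp
  have hr2 : r ^ 2 < 1 := by nlinarith [hr.1, hr.2]
  have h0 := norm_slitU (-θ)
  rw [← circle_one, sin_neg, abs_neg] at h0
  rw [e, mul_pow]
  set w := circleMap 0 1 θ ^ 2
  have nr : ‖(r:ℂ)^2 * w‖ = r ^ 2 := by rw [norm_mul, n1]; simp
  constructor
  · have h1 : ‖1 - w‖ ≤ ‖1 - (r:ℂ)^2 * w‖ + (1 - r^2) := by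
      have : 1 - w = (1 - (r:ℂ)^2 * w) - ((1 - r^2 : ℝ) : ℂ) * w := by push_cast; ring
      rw [this]
      refine (norm_sub_le _ _).trans ?_
      rw [norm_mul, n1, Complex.norm_real, norm_of_nonneg (by linarith)]; linarith
    have h2 : 1 - r^2 ≤ ‖1 - (r:ℂ)^2 * w‖ := by
      have := norm_sub_norm_le (1:ℂ) ((r:ℂ)^2 * w)
      rw [nr, norm_one] at this; exact this
    linarith
  · refine (norm_sub_le _ _).trans ?_
    rw [nr, norm_one]; linarith

theorem disc_slit {z : ℂ} (hz : z ∈ Metric.ball (0:ℂ) 1) : 1 - z ^ 2 ∈ Complex.slitPlane := by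
  left
  rw [mem_ball_zero_iff] at hz
  have h1 : (z^2).re ≤ ‖z^2‖ := Complex.re_le_norm _
  rw [norm_pow] at h1
  simp only [Complex.sub_re, Complex.one_re]
  nlinarith [norm_nonneg z]

theorem diff_h (n : ℕ) (a : ℂ) :
    DifferentiableOn ℂ (fun z : ℂ => z ^ n * (1 - z ^ 2) ^ a) (Metric.ball 0 1) := by
  intro z hz
  apply DifferentiableAt.differentiableWithinAt
  have := disc_slit hz
  refine DifferentiableAt.mul (by fun_prop) ?_
  exact DifferentiableAt.cpow (by fun_prop) (by fun_prop) this

theorem cont_h (n : ℕ) (a : ℂ) :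
    ∀ᵐ θ : ℝ, ContinuousAt (fun z : ℂ => z ^ n * (1 - z ^ 2) ^ a) (circleMap 0 1 θ) := by
  filter_upwards [ae_sin_ne] with θ hθ
  have : 1 - circleMap 0 1 θ ^ 2 ∈ Complex.slitPlane := by
    rw [circle_one]; exact slitU_slit (by simpa using hθ)
  refine ContinuousAt.mul (by fun_prop) ?_
  exact ContinuousAt.cpow (by fun_prop) (by fun_prop) this

theorem circle_pow (n : ℕ) (θ : ℝ) : circleMap 0 1 θ ^ n = Complex.exp (Complex.I * n * θ) := by
  rw [circleMap_zero, Complex.ofReal_one, one_mul, ← Complex.exp_nat_mul]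
  ring_nf

theorem int_neg_half (n : ℕ) :
    ∫ θ in (-π)..π, Complex.exp (-Complex.I * n * θ) * slitK θ = if n = 0 then 2 * (π : ℂ) else 0 := by
  have h := mean_boundary (fun z : ℂ => z ^ n * (1 - z ^ 2) ^ (-(1/2) : ℂ))
    (fun θ => 2 * ‖slitK θ‖) (diff_h _ _) ((slitK_intervalIntegrable _ _).norm.const_mul 2) ?_
    (cont_h _ _)
  · simp only [circle_one] at h
    simp only [circle_pow] at h
    have hN := intervalIntegral.integral_comp_neg (a := -π) (b := π)
      (fun θ : ℝ => Complex.exp (Complex.I * n * θ) * slitU (-θ) ^ (-(1/2) : ℂ))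
    rw [neg_neg] at hN
    rw [← hN] at h
    simp only [neg_neg, Complex.ofReal_neg] at h
    have e : ∀ θ : ℝ, Complex.exp (-Complex.I * n * θ) * slitK θ =
      Complex.exp (Complex.I * n * -θ) * slitU θ ^ (-(1/2) : ℂ) := by
        intro θ; rw [slitK]; congr 2; ring
    simp only [e]
    rw [h]
    split_ifs with hn <;> simp [hn]
  · intro r hr
    filter_upwards [ae_sin_ne] with θ hθ
    have hb := (half_bound r hr θ).1
    have hp := abs_pos.2 hθ
    have h1 := Complex.norm_cpow_real (1 - circleMap 0 r θ ^ 2) (-(1/2) : ℝ)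
    push_cast at h1
    rw [norm_mul, h1, norm_slitK, norm_pow, norm_circleMap_zero, abs_of_pos hr.1]
    have h2 : ‖1 - circleMap 0 r θ ^ 2‖ ^ (-(1/2) : ℝ) ≤ |sin θ| ^ (-(1/2) : ℝ) :=
      rpow_le_rpow_of_nonpos hp hb (by norm_num)
    have h3 : r ^ n ≤ 1 := pow_le_one₀ hr.1.le hr.2.le
    have h4 : (1:ℝ) ≤ 2 * 2 ^ (-(1/2) : ℝ) := by
      nth_rewrite 1 [← rpow_one 2]
      rw [← rpow_add two_pos]; exact one_le_rpow one_le_two (by norm_num)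
    rw [mul_rpow two_pos.le hp.le]
    have h5 : 0 < |sin θ| ^ (-(1/2) : ℝ) := rpow_pos_of_pos hp _
    calc _ ≤ 1 * |sin θ| ^ (-(1/2) : ℝ) := by gcongr
      _ ≤ (2 * 2 ^ (-(1/2) : ℝ)) * |sin θ| ^ (-(1/2) : ℝ) := by gcongr
      _ = _ := by ring

theorem int_half (n : ℕ) (hn : n ≠ 0) :
    ∫ θ in (-π)..π, Complex.exp (Complex.I * n * θ) * ((|sin θ| : ℝ) * slitK θ) = 0 := by
  have h := mean_boundary (fun z : ℂ => z ^ n * (1 - z ^ 2) ^ ((1/2) : ℂ))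
    (fun θ => 2 ^ (1/2 : ℝ)) (diff_h _ _) intervalIntegrable_const ?_
    (cont_h _ _)
  · simp only [circle_one] at h
    simp only [circle_pow] at h
    simp only [abs_sin_mul_slitK]
    have e : ∀ θ : ℝ, Complex.exp (Complex.I * n * θ) * (1 / 2 * slitU (-θ) ^ (1/2:ℂ)) =
      1 / 2 * (Complex.exp (Complex.I * n * θ) * slitU (-θ) ^ (1/2:ℂ)) := fun θ => by ring
    simp only [e]
    rw [intervalIntegral.integral_const_mul, h]
    simp [hn]
  · intro r hr
    refine ae_of_all _ fun θ => ?_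
    have hb := (half_bound r hr θ).2
    have h1 := Complex.norm_cpow_real (1 - circleMap 0 r θ ^ 2) ((1/2) : ℝ)
    push_cast at h1
    rw [norm_mul, h1, norm_pow, norm_circleMap_zero, abs_of_pos hr.1]
    have h3 : r ^ n ≤ 1 := pow_le_one₀ hr.1.le hr.2.le
    calc _ ≤ 1 * (2:ℝ) ^ ((1/2) : ℝ) := by gcongr
      _ = _ := one_mul _

noncomputable def slitW (θ : ℝ) : ℝ := cos θ / (1 + |sin θ|)

noncomputable def slitF (s k : ℤ) (θ : ℝ) : ℂ :=
  (slitW θ : ℂ) ^ k.natAbs * Complex.exp (-Complex.I * (s : ℂ) * (θ : ℂ)) * slitK θ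

theorem H0_eq_s14 (s k : ℤ) : H0 s k = (1 / (2 * (π : ℂ))) * ∫ θ in (-π)..π, slitF s k θ := rfl

theorem den_pos (θ : ℝ) : 0 < 1 + |sin θ| := by positivity

theorem slitW_cont : Continuous slitW := by
  unfold slitW
  exact continuous_cos.div (by fun_prop) fun θ => (den_pos θ).ne'

theorem slitW_quad (θ : ℝ) : cos θ * (slitW θ ^ 2 + 1) = 2 * slitW θ := by
  have h := (den_pos θ).ne'
  have h2 : cos θ ^ 2 = (1 + |sin θ|) * (1 - |sin θ|) := by
    rw [cos_sq', ← sq_abs]; ring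
  unfold slitW
  rw [div_pow, h2]
  field_simp
  ring

theorem slitW_cos (θ : ℝ) : cos θ * slitW θ = 1 - |sin θ| := by
  have h := (den_pos θ).ne'
  have h2 : cos θ ^ 2 = (1 + |sin θ|) * (1 - |sin θ|) := by
    rw [cos_sq', ← sq_abs]; ring
  unfold slitW
  field_simp
  linarith

theorem slitW_abs_le (θ : ℝ) : |slitW θ| ≤ 1 := by
  unfold slitW
  rw [abs_div, abs_of_pos (den_pos θ), div_le_one (den_pos θ)]
  linarith [abs_cos_le_one θ, abs_nonneg (sin θ)]

theorem slitW_abs_lt {θ : ℝ} (h : sin θ ≠ 0) : |slitW θ| < 1 := by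
  unfold slitW
  rw [abs_div, abs_of_pos (den_pos θ), div_lt_one (den_pos θ)]
  linarith [abs_cos_le_one θ, abs_pos.2 h]

theorem slitF_int (s k : ℤ) : IntervalIntegrable (slitF s k) volume (-π) π := by
  have hc : Continuous fun θ : ℝ =>
      (slitW θ : ℂ) ^ k.natAbs * Complex.exp (-Complex.I * (s : ℂ) * (θ : ℂ)) := by
    have := slitW_cont
    fun_prop
  exact (slitK_intervalIntegrable _ _).continuousOn_mul hc.continuousOn

theorem slitF_sum (s k : ℤ) (θ : ℝ) :
    slitF (s+1) (k+1) θ + slitF (s+1) (k-1) θ + slitF (s-1) (k+1) θ + slitF (s-1) (k-1) θ =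
      ((slitW θ : ℂ) ^ (k+1).natAbs + (slitW θ : ℂ) ^ (k-1).natAbs) * (2 * (cos θ : ℝ)) *
        Complex.exp (-Complex.I * (s : ℂ) * (θ : ℂ)) * slitK θ := by
  have e1 : Complex.exp (-Complex.I * ((s+1 : ℤ) : ℂ) * (θ : ℂ)) =
      Complex.exp (-Complex.I * (s : ℂ) * (θ : ℂ)) * Complex.exp (-θ * Complex.I) := by
    rw [← Complex.exp_add]; push_cast; ring_nf
  have e2 : Complex.exp (-Complex.I * ((s-1 : ℤ) : ℂ) * (θ : ℂ)) =
      Complex.exp (-Complex.I * (s : ℂ) * (θ : ℂ)) * Complex.exp (θ * Complex.I) := by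
    rw [← Complex.exp_add]; push_cast; ring_nf
  have e3 : 2 * ((cos θ : ℝ) : ℂ) = Complex.exp (θ * Complex.I) + Complex.exp (-θ * Complex.I) := by
    rw [Complex.ofReal_cos, Complex.two_cos]
  unfold slitF
  rw [e1, e2, e3]
  ring

theorem slitF_sum_ne (s k : ℤ) (hk : k ≠ 0) (θ : ℝ) :
    slitF (s+1) (k+1) θ + slitF (s+1) (k-1) θ + slitF (s-1) (k+1) θ + slitF (s-1) (k-1) θ =
      4 * slitF s k θ := by
  rw [slitF_sum]
  have hq : ((cos θ : ℝ) : ℂ) * ((slitW θ : ℂ) ^ 2 + 1) = 2 * (slitW θ : ℂ) := by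
    exact_mod_cast slitW_quad θ
  obtain ⟨n, hn⟩ : ∃ n, k.natAbs = n + 1 := ⟨k.natAbs - 1, by omega⟩
  have hs : (slitW θ : ℂ) ^ (k+1).natAbs + (slitW θ : ℂ) ^ (k-1).natAbs =
      (slitW θ : ℂ) ^ n * ((slitW θ : ℂ) ^ 2 + 1) := by
    rcases lt_or_gt_of_ne hk with h | h
    · rw [show (k+1).natAbs = n by omega, show (k-1).natAbs = n + 2 by omega]; ring
    · rw [show (k+1).natAbs = n + 2 by omega, show (k-1).natAbs = n by omega]; ring
  unfold slitF
  rw [hs, hn]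
  linear_combination (2 * (slitW θ : ℂ) ^ n * Complex.exp (-Complex.I * (s : ℂ) * (θ : ℂ))
    * slitK θ) * hq

theorem slitF_sum_zero (s : ℤ) (θ : ℝ) :
    slitF (s+1) (0+1) θ + slitF (s+1) (0-1) θ + slitF (s-1) (0+1) θ + slitF (s-1) (0-1) θ =
      4 * slitF s 0 θ -
        4 * (Complex.exp (-Complex.I * (s : ℂ) * (θ : ℂ)) * ((|sin θ| : ℝ) * slitK θ)) := by
  rw [slitF_sum]
  have hq : ((cos θ : ℝ) : ℂ) * (slitW θ : ℂ) = 1 - ((|sin θ| : ℝ) : ℂ) := by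
    exact_mod_cast slitW_cos θ
  unfold slitF
  simp only [zero_add, zero_sub, Int.natAbs_neg, Int.natAbs_one, pow_one, Int.natAbs_zero, pow_zero]
  linear_combination (4 * Complex.exp (-Complex.I * (s : ℂ) * (θ : ℂ)) * slitK θ) * hq

theorem H0_harm (s k : ℤ) (h : k ≠ 0 ∨ s ≤ -1) :
    H0 (s+1) (k+1) + H0 (s+1) (k-1) + H0 (s-1) (k+1) + H0 (s-1) (k-1) = 4 * H0 s k := by
  have hsum : H0 (s+1) (k+1) + H0 (s+1) (k-1) + H0 (s-1) (k+1) + H0 (s-1) (k-1) =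
      (1 / (2 * (π : ℂ))) * ∫ θ in (-π)..π, (slitF (s+1) (k+1) θ + slitF (s+1) (k-1) θ +
        slitF (s-1) (k+1) θ + slitF (s-1) (k-1) θ) := by
    rw [intervalIntegral.integral_add (((slitF_int _ _).add (slitF_int _ _)).add (slitF_int _ _))
        (slitF_int _ _),
      intervalIntegral.integral_add ((slitF_int _ _).add (slitF_int _ _)) (slitF_int _ _),
      intervalIntegral.integral_add (slitF_int _ _) (slitF_int _ _)]
    simp only [H0_eq_s14]; ring
  rw [hsum]
  by_cases hk : k = 0
  · subst hk
    have hs : s ≤ -1 := by simpa using h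
    obtain ⟨n, rfl⟩ : ∃ n : ℕ, s = -(n : ℤ) := ⟨s.natAbs, by omega⟩
    have hn : n ≠ 0 := by omega
    simp only [slitF_sum_zero]
    have hc : Continuous fun θ : ℝ =>
        Complex.exp (-Complex.I * ((-(n:ℤ) : ℤ) : ℂ) * (θ : ℂ)) * ((|sin θ| : ℝ) : ℂ) := by
      fun_prop
    have hI := ((slitK_intervalIntegrable (-π) π).continuousOn_mul hc.continuousOn)
    simp only [mul_assoc] at hI
    rw [intervalIntegral.integral_sub ((slitF_int _ _).const_mul 4)
      (by simpa only [mul_assoc] using hI.const_mul 4),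
      intervalIntegral.integral_const_mul, intervalIntegral.integral_const_mul, H0_eq_s14]
    have e : ∀ θ : ℝ, Complex.exp (-Complex.I * ((-(n:ℤ) : ℤ) : ℂ) * (θ : ℂ)) =
        Complex.exp (Complex.I * n * θ) := by
      intro θ; push_cast; ring_nf
    simp only [e]
    rw [int_half n hn]
    ring
  · simp only [slitF_sum_ne s k hk]
    rw [intervalIntegral.integral_const_mul, H0_eq_s14]; ring

theorem H0_bd (j : ℤ) (hj : 0 ≤ j) : H0 j 0 = if j = 0 then 1 else 0 := by
  obtain ⟨n, rfl⟩ := Int.eq_ofNat_of_zero_le hj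
  have h := int_neg_half n
  have e : ∀ θ, slitF n 0 θ = Complex.exp (-Complex.I * n * θ) * slitK θ := by
    intro θ; simp [slitF]
  rw [H0_eq_s14]
  simp only [e]
  rw [h]
  have : (π : ℂ) ≠ 0 := by exact_mod_cast pi_ne_zero
  simp only [Nat.cast_eq_zero]
  split_ifs
  · field_simp
  · simp

theorem slitF_norm (s k : ℤ) (θ : ℝ) : ‖slitF s k θ‖ = |slitW θ| ^ k.natAbs * ‖slitK θ‖ := by
  have : -Complex.I * (s : ℂ) * (θ : ℂ) = ((-(s * θ) : ℝ) : ℂ) * Complex.I := by push_cast; ring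
  rw [slitF, this, norm_mul, norm_mul, Complex.norm_exp_ofReal_mul_I, mul_one, norm_pow,
    Complex.norm_real, norm_eq_abs]

theorem decay_k : Tendsto (fun n : ℕ => ∫ θ in (-π)..π, |slitW θ| ^ n * ‖slitK θ‖) atTop (𝓝 0) := by
  have : Tendsto (fun n : ℕ => ∫ θ in (-π)..π, |slitW θ| ^ n * ‖slitK θ‖) atTop
      (𝓝 (∫ θ in (-π)..π, (0:ℝ))) := by
    apply intervalIntegral.tendsto_integral_filter_of_dominated_convergence (fun θ => ‖slitK θ‖)
    · refine Eventually.of_forall fun n => ?_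
      exact ((slitW_cont.abs.pow n).measurable.mul slitK_measurable.norm).aestronglyMeasurable
    · refine Eventually.of_forall fun n => ae_of_all _ fun θ _ => ?_
      rw [norm_of_nonneg (by positivity)]
      exact mul_le_of_le_one_left (norm_nonneg _) (pow_le_one₀ (abs_nonneg _) (slitW_abs_le θ))
    · exact (slitK_intervalIntegrable _ _).norm
    · filter_upwards [ae_sin_ne] with θ hθ _
      simpa using (tendsto_pow_atTop_nhds_zero_of_lt_one (abs_nonneg _)
        (slitW_abs_lt hθ)).mul_const ‖slitK θ‖
  simpa using this

theorem H0_norm_le (s k : ℤ) :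
    ‖H0 s k‖ ≤ ∫ θ in (-π)..π, |slitW θ| ^ k.natAbs * ‖slitK θ‖ := by
  have hp := pi_gt_three
  have h1 : ‖∫ θ in (-π)..π, slitF s k θ‖ ≤ ∫ θ in (-π)..π, |slitW θ| ^ k.natAbs * ‖slitK θ‖ := by
    refine (intervalIntegral.norm_integral_le_integral_norm (by linarith)).trans_eq ?_
    simp only [slitF_norm]
  rw [H0_eq_s14, norm_mul]
  refine le_trans (mul_le_of_le_one_left (norm_nonneg _) ?_) h1
  rw [norm_div, norm_one, norm_mul, Complex.norm_real, Complex.norm_ofNat,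
    norm_of_nonneg (by linarith), div_le_one (by linarith)]
  linarith

theorem decay_s (k : ℤ) : Tendsto (fun s : ℤ => H0 s k) cofinite (𝓝 0) := by
  have h := Real.tendsto_integral_exp_smul_cocompact
    ((Ioc (-π) π).indicator fun θ => (slitW θ : ℂ) ^ k.natAbs * slitK θ)
  have hw : Tendsto (fun s : ℤ => (s : ℝ) * (2 * π)⁻¹) cofinite (cocompact ℝ) :=
    ((Homeomorph.mulRight₀ ((2 * π)⁻¹ : ℝ) (by positivity)).isClosedEmbedding.tendsto_cocompact).comp
      Int.tendsto_coe_cofinite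
  have h2 := (h.comp hw).const_mul (1 / (2 * (π : ℂ)))
  rw [mul_zero] at h2
  refine h2.congr fun s => ?_
  rw [H0_eq_s14, intervalIntegral.integral_of_le (by linarith [pi_pos]),
    ← integral_indicator measurableSet_Ioc]
  simp only [Function.comp]
  congr 2
  ext θ
  by_cases hθ : θ ∈ Ioc (-π) π
  · rw [indicator_of_mem hθ, indicator_of_mem hθ, Circle.smul_def, Real.fourierChar_apply,
      smul_eq_mul, slitF]
    have : ((2 * π * -(θ * (s * (2 * π)⁻¹)) : ℝ) : ℂ) * Complex.I = -Complex.I * s * θ := by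
      have : 2 * π * -(θ * (s * (2 * π)⁻¹)) = - (s * θ) := by
        have := pi_ne_zero
        field_simp
      rw [this]; push_cast; ring
    rw [this]; ring
  · rw [indicator_of_notMem hθ, indicator_of_notMem hθ, smul_zero]

theorem H0_decay (ε : ℝ) (hε : 0 < ε) :
    ∃ R : ℕ, ∀ s k : ℤ, (R : ℤ) ≤ |s| + |k| → ‖H0 s k‖ ≤ ε := by
  obtain ⟨N, hN⟩ := eventually_atTop.1 (decay_k.eventually (gt_mem_nhds hε))
  have hfin : {p : ℤ × ℤ | ¬ ‖H0 p.1 p.2‖ ≤ ε}.Finite := by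
    refine Set.Finite.subset (s := ⋃ k ∈ Set.Icc (-(N:ℤ)) N,
      (fun s : ℤ => (s, k)) '' {s : ℤ | ¬ ‖H0 s k‖ ≤ ε}) ?_ ?_
    · refine (Set.finite_Icc _ _).biUnion fun k _ => Set.Finite.image _ ?_
      have h1 : ∀ᶠ s in cofinite, ‖H0 s k‖ < ε := by
        have := (decay_s k).norm
        rw [norm_zero] at this
        exact this.eventually (gt_mem_nhds hε)
      exact eventually_cofinite.1 (h1.mono fun s h => h.le)
    · rintro ⟨s, k⟩ hp
      simp only [Set.mem_ofPred_eq] at hp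
      simp only [Set.mem_iUnion]
      refine ⟨k, ?_, s, hp, rfl⟩
      by_contra hk
      apply hp
      refine (H0_norm_le s k).trans (hN _ ?_).le
      rw [Set.mem_Icc] at hk
      omega
  obtain ⟨M, hM⟩ := (hfin.image fun p => |p.1| + |p.2|).bddAbove
  refine ⟨(M + 1).toNat, fun s k h => ?_⟩
  by_contra hc
  have := hM ⟨(s, k), hc, rfl⟩
  simp only at this
  omega

theorem harmonic_measure_slit_recursion (m : ℤ) (hm : 1 ≤ m) (L : ℤ × ℤ → ℂ)
    (hharm : ∀ s k : ℤ, (k ≠ 0 ∨ s ≤ -1) →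
      L (s + 1, k + 1) + L (s + 1, k - 1) + L (s - 1, k + 1) + L (s - 1, k - 1)
        = 4 * L (s, k))
    (hbd : ∀ j : ℤ, 0 ≤ j → L (j, 0) = if j = m - 1 then 1 else 0)
    (hinf : ∀ ε : ℝ, 0 < ε → ∃ R : ℕ, ∀ s k : ℤ, (R : ℤ) ≤ |s| + |k| → ‖L (s, k)‖ ≤ ε) :
    ∀ L' : ℤ × ℤ → ℂ, (∀ s k : ℤ, L' (s, k) = L (s - 1, k) - L (-1, 0) * H0 s k) →
      (∀ s k : ℤ, (k ≠ 0 ∨ s ≤ -1) →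
        L' (s + 1, k + 1) + L' (s + 1, k - 1) + L' (s - 1, k + 1) + L' (s - 1, k - 1)
          = 4 * L' (s, k)) ∧
      (∀ j : ℤ, 0 ≤ j → L' (j, 0) = if j = m then 1 else 0) ∧
      (∀ ε : ℝ, 0 < ε → ∃ R : ℕ, ∀ s k : ℤ, (R : ℤ) ≤ |s| + |k| → ‖L' (s, k)‖ ≤ ε) := by
  intro L' hL'
  refine ⟨fun s k h => ?_, fun j hj => ?_, fun ε hε => ?_⟩
  · have h1 := hharm (s - 1) k (h.imp id fun h => by omega)
    have h2 := H0_harm s k h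
    simp only [hL']
    rw [show s + 1 - 1 = s - 1 + 1 by ring]
    linear_combination h1 - L (-1, 0) * h2
  · rw [hL', H0_bd j hj]
    rcases eq_or_lt_of_le hj with rfl | hj'
    · rw [if_neg (show ¬ (0 = m) by omega)]; simp
    · rw [hbd (j - 1) (by omega), if_neg hj'.ne']
      simp
  · obtain ⟨R1, h1⟩ := hinf (ε / 2) (by positivity)
    obtain ⟨R2, h2⟩ := H0_decay (ε / 2 / (‖L (-1, 0)‖ + 1)) (by positivity)
    refine ⟨R1 + 1 + R2, fun s k h => ?_⟩
    have a0 : |s| - 1 ≤ |s - 1| := by simpa using abs_sub_abs_le_abs_sub s 1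
    have a1 := h1 (s - 1) k (by push_cast at h; omega)
    have a2 := h2 s k (by push_cast at h; omega)
    rw [le_div_iff₀ (by positivity)] at a2
    rw [hL']
    refine (norm_sub_le _ _).trans ?_
    rw [norm_mul]
    nlinarith [norm_nonneg (H0 s k)]
end
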